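/- Let d ≥ 1, α ∈ (0,2], β > 0 with β < d < αβ, and c_1, …, c_d > 0. Set a_i = ‖i‖^{−β} for i ∈ ℤ^d \ {0}, Γ_n^d = {k ∈ ℤ^d : |k_l| ≤ c_l n, l = 1, …, d}, and b_{ni} = Σ_{j∈Γ_n^d} ‖j − i‖^{−β}. Then B_n = (Σ_{i∈ℤ^d} |b_{ni}|^α)^{1/α} satisfies B_n ~ n^{d − β + d/α} · ( ∫_{ℝ^d} | ∫_I ‖x − y‖^{−β} dx |^α dy )^{1/α} as n → ∞, where I = Π_{l=1}^d [−c_l, c_l]; in particular B_n ~ C_1 n^{(1+1/α)d − β} for a positive finite constant C_1, and sup_i |b_{ni}| ~ C_2 n^{d−β} for a positive finite constant C_2. -/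

import Mathlib

open MeasureTheory Filter Topology

noncomputable section

/-- The lattice point `k ∈ ℤ^d` viewed as a vector of the Euclidean space `ℝ^d`. -/
def evec {d : ℕ} (k : Fin d → ℤ) : EuclideanSpace ℝ (Fin d) :=
  (WithLp.equiv 2 (Fin d → ℝ)).symm (fun l => (k l : ℝ))

lemma evec_apply {d : ℕ} (k : Fin d → ℤ) (l : Fin d) : evec k l = (k l : ℝ) := rfl

/-- componentwise floor of `n • y` -/
def flo {d : ℕ} (n : ℕ) (y : EuclideanSpace ℝ (Fin d)) : Fin d → ℤ := fun l => ⌊(n : ℝ) * y l⌋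

lemma norm_le_sum_abs {d : ℕ} (x : EuclideanSpace ℝ (Fin d)) : ‖x‖ ≤ ∑ l, |x l| := by
  rw [EuclideanSpace.norm_eq]
  apply Real.sqrt_le_iff.2
  refine ⟨Finset.sum_nonneg fun _ _ => abs_nonneg _, ?_⟩
  simpa using Finset.sum_sq_le_sq_sum_of_nonneg (s := Finset.univ) (f := fun l => |x l|)
    (fun _ _ => abs_nonneg _)

lemma measurable_flo {d : ℕ} (n : ℕ) :
    Measurable (flo n : EuclideanSpace ℝ (Fin d) → (Fin d → ℤ)) := by
  refine measurable_pi_iff.2 fun l => ?_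
  unfold flo
  exact Int.measurable_floor.comp (by fun_prop)

lemma volume_flo {d : ℕ} (n : ℕ) (hn : 0 < n) (i : Fin d → ℤ) :
    volume {y : EuclideanSpace ℝ (Fin d) | flo n y = i} = ENNReal.ofReal ((n : ℝ) ^ (-(d : ℝ))) := by
  have hn' : (0 : ℝ) < n := by exact_mod_cast hn
  have h : {y : EuclideanSpace ℝ (Fin d) | flo n y = i} = (@WithLp.ofLp 2 (Fin d → ℝ)) ⁻¹'
      (Set.univ.pi fun l => Set.Ico ((i l : ℝ) / n) (((i l : ℝ) + 1) / n)) := by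
    ext y
    simp only [Set.mem_ofPred_eq, Set.mem_preimage, Set.mem_univ_pi, Set.mem_Ico, funext_iff, flo,
      Int.floor_eq_iff, div_le_iff₀ hn', lt_div_iff₀ hn']
    simp only [mul_comm]
  rw [h, (PiLp.volume_preserving_ofLp (Fin d)).measure_preimage
    (MeasurableSet.univ_pi fun _ => measurableSet_Ico).nullMeasurableSet, Real.volume_pi_Ico]
  have : ∀ l, ((i l : ℝ) + 1) / n - (i l : ℝ) / n = (n : ℝ)⁻¹ := by intro l; ring
  simp only [this]
  rw [Finset.prod_const, ← ENNReal.ofReal_pow (by positivity)]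
  simp [Real.rpow_neg hn'.le]

lemma integral_flo {d : ℕ} (n : ℕ) (hn : 0 < n) (F : (Fin d → ℤ) → ℝ)
    (hF : Integrable (fun y : EuclideanSpace ℝ (Fin d) => F (flo n y))) :
    ∫ y : EuclideanSpace ℝ (Fin d), F (flo n y) = (n : ℝ) ^ (-(d : ℝ)) * ∑' i, F i := by
  have hm : Measurable F := measurable_of_countable F
  have hi : Integrable F (volume.map (flo n : EuclideanSpace ℝ (Fin d) → _)) :=
    (integrable_map_measure hm.aestronglyMeasurable (measurable_flo n).aemeasurable).2 hF
  rw [← integral_map (measurable_flo n).aemeasurable hm.aestronglyMeasurable,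
    integral_countable hi, ← tsum_mul_left]
  refine tsum_congr fun i => ?_
  rw [Measure.real, Measure.map_apply (measurable_flo n) (measurableSet_singleton _)]
  have : (flo n : EuclideanSpace ℝ (Fin d) → _) ⁻¹' {i} = {y | flo n y = i} := rfl
  rw [this, volume_flo n hn, ENNReal.toReal_ofReal (by positivity), smul_eq_mul]

lemma ae_coord_ne {d : ℕ} (l : Fin d) (a : ℝ) :
    ∀ᵐ u : EuclideanSpace ℝ (Fin d), u l ≠ a := by
  have h : ∀ᵐ v : Fin d → ℝ, v l ≠ a := by
    have := Measure.ae_eval_ne (fun _ : Fin d => (volume : Measure ℝ)) l a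
    exact this
  exact (PiLp.volume_preserving_ofLp (Fin d)).quasiMeasurePreserving.ae h

lemma intOn_ball {d : ℕ} (hd : 0 < d) (β : ℝ) (hβ : β < d) (r : ℝ) (hr : 0 < r) :
    IntegrableOn (fun u : EuclideanSpace ℝ (Fin d) => ‖u‖ ^ (-β)) (Metric.ball 0 r) := by
  have : Nonempty (Fin d) := ⟨⟨0, hd⟩⟩
  have : Nontrivial (EuclideanSpace ℝ (Fin d)) := by infer_instance
  refine (integrableOn_fun_norm_addHaar (volume : Measure (EuclideanSpace ℝ (Fin d)))
    (f := fun t => t ^ (-β))).2 ?_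
  have h := (intervalIntegral.integrableOn_Ioo_rpow_iff (s := (d : ℝ) - 1 - β) hr).2 (by linarith)
  refine h.congr_fun (fun x hx => ?_) measurableSet_Ioo
  simp only [finrank_euclideanSpace, Fintype.card_fin, smul_eq_mul]
  rw [sub_eq_add_neg _ β, Real.rpow_add hx.1, ← Real.rpow_natCast, Nat.cast_sub (by omega)]
  simp

/-- the bounding kernel -/
def Dk {d : ℕ} (β R : ℝ) (y u : EuclideanSpace ℝ (Fin d)) : ℝ :=
  (Metric.closedBall (0 : EuclideanSpace ℝ (Fin d)) R).indicator (fun _ => ‖u‖ ^ (-β)) (y + u)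

lemma Dk_le {d : ℕ} (β R : ℝ) (hβ0 : 0 < β) (y u : EuclideanSpace ℝ (Fin d)) :
    Dk β R y u ≤ (Metric.ball (0 : EuclideanSpace ℝ (Fin d)) 1).indicator (fun u => ‖u‖ ^ (-β)) u
      + (Metric.closedBall (-y) R).indicator (fun _ => (1:ℝ)) u := by
  unfold Dk
  by_cases h : y + u ∈ Metric.closedBall (0 : EuclideanSpace ℝ (Fin d)) R
  · have h' : u ∈ Metric.closedBall (-y) R := by
      simp only [Metric.mem_closedBall, dist_eq_norm] at h ⊢
      simpa [add_comm] using h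
    rw [Set.indicator_of_mem h, Set.indicator_of_mem h']
    by_cases h2 : u ∈ Metric.ball (0 : EuclideanSpace ℝ (Fin d)) 1
    · rw [Set.indicator_of_mem h2]; linarith
    · rw [Set.indicator_of_notMem h2]
      have : 1 ≤ ‖u‖ := by simpa using h2
      have := Real.rpow_le_one_of_one_le_of_nonpos this (z := -β) (by linarith)
      linarith
  · rw [Set.indicator_of_notMem h]
    refine add_nonneg (Set.indicator_nonneg (fun _ _ => by positivity) _)
      (Set.indicator_nonneg (fun _ _ => by positivity) _)

lemma Dk_nonneg {d : ℕ} (β R : ℝ) (y u : EuclideanSpace ℝ (Fin d)) : 0 ≤ Dk β R y u :=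
  Set.indicator_nonneg (fun _ _ => by positivity) _

lemma Dk_meas {d : ℕ} (β R : ℝ) (y : EuclideanSpace ℝ (Fin d)) : Measurable (Dk β R y) := by
  have : Dk β R y = fun u => ((fun u => y + u) ⁻¹' Metric.closedBall
      (0 : EuclideanSpace ℝ (Fin d)) R).indicator (fun u => ‖u‖ ^ (-β)) u := by
    rfl
  rw [this]
  refine Measurable.indicator (by fun_prop) ?_
  exact measurableSet_closedBall.preimage (by fun_prop)

lemma Dk_bd_int {d : ℕ} (hd : 0 < d) (β R : ℝ) (hβ : β < d) (y : EuclideanSpace ℝ (Fin d)) :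
    Integrable (fun u => (Metric.ball (0 : EuclideanSpace ℝ (Fin d)) 1).indicator
        (fun u => ‖u‖ ^ (-β)) u
      + (Metric.closedBall (-y) R).indicator (fun _ => (1:ℝ)) u) := by
  refine Integrable.add ?_ ?_
  · exact (integrable_indicator_iff measurableSet_ball).2 (intOn_ball hd β hβ 1 one_pos)
  · refine (integrable_indicator_iff measurableSet_closedBall).2 ?_
    exact integrableOn_const (measure_closedBall_lt_top.ne)

lemma Dk_int {d : ℕ} (hd : 0 < d) (β R : ℝ) (hβ : β < d) (hβ0 : 0 < β)
    (y : EuclideanSpace ℝ (Fin d)) : Integrable (Dk β R y) := by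
  refine (Dk_bd_int hd β R hβ y).mono' (Dk_meas β R y).aestronglyMeasurable ?_
  filter_upwards with u
  rw [Real.norm_of_nonneg (Dk_nonneg _ _ _ _)]
  exact Dk_le β R hβ0 y u

lemma Dk_integral_le {d : ℕ} (hd : 0 < d) (β R : ℝ) (hβ : β < d) (hβ0 : 0 < β) (hR : 1 ≤ R) :
    ∃ C : ℝ, 0 < C ∧ ∀ y : EuclideanSpace ℝ (Fin d),
      ∫ u, Dk β R y u ≤ C * (1 + ‖y‖) ^ (-β) := by
  set V : ℝ := volume.real (Metric.closedBall (0 : EuclideanSpace ℝ (Fin d)) R)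
  have hVn : 0 ≤ V := measureReal_nonneg
  have hV : ∀ y : EuclideanSpace ℝ (Fin d), volume.real (Metric.closedBall y R) = V := by
    intro y; simp only [V, Measure.real]; rw [Measure.addHaar_closedBall_center]
  set A : ℝ := ∫ u, (Metric.ball (0 : EuclideanSpace ℝ (Fin d)) 1).indicator (fun u => ‖u‖ ^ (-β)) u
  have hA : 0 ≤ A := integral_nonneg fun u => Set.indicator_nonneg (fun _ _ => by positivity) _
  have h1 : ∀ y : EuclideanSpace ℝ (Fin d), ∫ u, Dk β R y u ≤ A + V := by
    intro y
    refine (integral_mono (Dk_int hd β R hβ hβ0 y) (Dk_bd_int hd β R hβ y)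
      (Dk_le β R hβ0 y)).trans ?_
    rw [integral_add]
    · rw [integral_indicator measurableSet_closedBall]
      simp [hV, A]
    · exact (integrable_indicator_iff measurableSet_ball).2 (intOn_ball hd β hβ 1 one_pos)
    · refine (integrable_indicator_iff measurableSet_closedBall).2 ?_
      exact integrableOn_const (measure_closedBall_lt_top.ne)
  have h2 : ∀ y : EuclideanSpace ℝ (Fin d), 2 * R ≤ ‖y‖ →
      ∫ u, Dk β R y u ≤ V * ((1 + ‖y‖) / 4) ^ (-β) := by
    intro y hy
    have hb : ∀ u, Dk β R y u ≤ (Metric.closedBall (-y) R).indicator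
        (fun _ => ((1 + ‖y‖) / 4) ^ (-β)) u := by
      intro u
      unfold Dk
      by_cases h : y + u ∈ Metric.closedBall (0 : EuclideanSpace ℝ (Fin d)) R
      · have h' : u ∈ Metric.closedBall (-y) R := by
          simp only [Metric.mem_closedBall, dist_eq_norm] at h ⊢
          simpa [add_comm] using h
        rw [Set.indicator_of_mem h, Set.indicator_of_mem h']
        have h3 : ‖y + u‖ ≤ R := by simpa using h
        have h4 : ‖y‖ ≤ ‖y + u‖ + ‖u‖ := by
          have := norm_sub_le (y + u) u
          simpa using this
        exact Real.rpow_le_rpow_of_nonpos (by positivity) (by linarith) (by linarith)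
      · rw [Set.indicator_of_notMem h]
        exact Set.indicator_nonneg (fun _ _ => by positivity) _
    refine (integral_mono (Dk_int hd β R hβ hβ0 y) ?_ hb).trans ?_
    · refine (integrable_indicator_iff measurableSet_closedBall).2 ?_
      exact integrableOn_const (measure_closedBall_lt_top.ne)
    · rw [integral_indicator measurableSet_closedBall]
      simp [hV]
  refine ⟨(A + V + 1) * (1 + 2 * R) ^ β + V * 4 ^ β, by positivity, fun y => ?_⟩
  have hy0 := norm_nonneg y
  rcases le_total (2 * R) ‖y‖ with hy | hy
  · refine (h2 y hy).trans ?_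
    rw [Real.div_rpow (by positivity) (by norm_num), Real.rpow_neg (by norm_num : (0:ℝ) ≤ 4),
      div_inv_eq_mul, add_mul]
    have : 0 ≤ (A + V + 1) * (1 + 2 * R) ^ β * (1 + ‖y‖) ^ (-β) := by positivity
    linarith
  · refine (h1 y).trans ?_
    have : 1 ≤ (1 + 2 * R) ^ β * (1 + ‖y‖) ^ (-β) := by
      rw [Real.rpow_neg (by positivity), ← div_eq_mul_inv, one_le_div (by positivity)]
      exact Real.rpow_le_rpow (by positivity) (by linarith) hβ0.le
    rw [add_mul, mul_assoc]
    have h5 : 0 ≤ V * 4 ^ β * (1 + ‖y‖) ^ (-β) := by positivity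
    nlinarith

/-- the index box -/
def Gam {d : ℕ} (c : Fin d → ℝ) (n : ℕ) : Finset (Fin d → ℤ) :=
  Fintype.piFinset fun l => Finset.Icc (-(⌊c l * n⌋)) ⌊c l * n⌋

lemma mem_Gam {d : ℕ} (c : Fin d → ℝ) (n : ℕ) (j : Fin d → ℤ) :
    j ∈ Gam c n ↔ ∀ l, -(⌊c l * n⌋) ≤ j l ∧ j l ≤ ⌊c l * n⌋ := by
  simp [Gam, Fintype.mem_piFinset]

/-- discretised summand at the index `j` -/
def Fj {d : ℕ} (β : ℝ) (c : Fin d → ℝ) (n : ℕ) (i j : Fin d → ℤ) : ℝ :=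
  if j ∈ Gam c n then (n : ℝ) ^ β * ‖evec (j - i)‖ ^ (-β) else 0

/-- discretised kernel -/
def hk {d : ℕ} (β : ℝ) (c : Fin d → ℝ) (n : ℕ) (y u : EuclideanSpace ℝ (Fin d)) : ℝ :=
  Fj β c n (flo n y) (flo n (y + u))

lemma hk_nonneg {d : ℕ} (β : ℝ) (c : Fin d → ℝ) (n : ℕ) (y u : EuclideanSpace ℝ (Fin d)) :
    0 ≤ hk β c n y u := by
  unfold hk Fj
  split_ifs <;> positivity

lemma hk_meas {d : ℕ} (β : ℝ) (c : Fin d → ℝ) (n : ℕ) (y : EuclideanSpace ℝ (Fin d)) :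
    Measurable (hk β c n y) := by
  have h1 : Measurable (Fj β c n (flo n y)) := measurable_of_countable _
  exact h1.comp ((measurable_flo n).comp (by fun_prop))

/-- radius -/
def Rad {d : ℕ} (c : Fin d → ℝ) : ℝ := 1 + ∑ l, (c l + 1)

lemma one_le_Rad {d : ℕ} (c : Fin d → ℝ) (hc : ∀ l, 0 < c l) : 1 ≤ Rad c := by
  unfold Rad
  have : 0 ≤ ∑ l, (c l + 1) := Finset.sum_nonneg fun l _ => by linarith [hc l]
  linarith

lemma flo_mem_ball {d : ℕ} (c : Fin d → ℝ) (hc : ∀ l, 0 < c l) (n : ℕ) (hn : 0 < n)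
    (x : EuclideanSpace ℝ (Fin d)) (hx : flo n x ∈ Gam c n) : ‖x‖ ≤ Rad c := by
  have hn' : (1 : ℝ) ≤ n := by exact_mod_cast hn
  rw [mem_Gam] at hx
  refine (norm_le_sum_abs x).trans ?_
  have : ∑ l, |x l| ≤ ∑ l, (c l + 1) := by
    refine Finset.sum_le_sum fun l _ => ?_
    obtain ⟨h1, h2⟩ := hx l
    simp only [flo] at h1 h2
    have f1 : ((⌊c l * n⌋ : ℤ) : ℝ) ≤ c l * n := Int.floor_le _
    have f2 : ((⌊n * x l⌋ : ℤ) : ℝ) ≤ n * x l := Int.floor_le _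
    have f3 : (n * x l : ℝ) < ⌊n * x l⌋ + 1 := Int.lt_floor_add_one _
    have h1' : -((⌊c l * n⌋ : ℤ) : ℝ) ≤ ((⌊n * x l⌋ : ℤ) : ℝ) := by exact_mod_cast h1
    have h2' : ((⌊n * x l⌋ : ℤ) : ℝ) ≤ ((⌊c l * n⌋ : ℤ) : ℝ) := by exact_mod_cast h2
    have hcl := hc l
    rw [abs_le]
    constructor
    · by_contra hlt
      push Not at hlt
      nlinarith
    · by_contra hlt
      push Not at hlt
      nlinarith
  unfold Rad
  linarith

lemma one_le_norm_evec {d : ℕ} (k : Fin d → ℤ) (hk : k ≠ 0) : 1 ≤ ‖evec k‖ := by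
  obtain ⟨l, hl⟩ := Function.ne_iff.1 hk
  refine le_trans ?_ (PiLp.norm_apply_le (evec k) l)
  rw [evec_apply, Real.norm_eq_abs]
  exact_mod_cast Int.one_le_abs hl

lemma flo_sub_norm {d : ℕ} (n : ℕ) (y u : EuclideanSpace ℝ (Fin d)) :
    ‖(n : ℝ) • u - evec (flo n (y + u) - flo n y)‖ ≤ d := by
  refine (norm_le_sum_abs _).trans ?_
  have : ∀ l ∈ (Finset.univ : Finset (Fin d)),
      |((n : ℝ) • u - evec (flo n (y + u) - flo n y)) l| ≤ 1 := by
    intro l _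
    simp only [PiLp.sub_apply, PiLp.smul_apply, evec_apply, Pi.sub_apply, flo, smul_eq_mul,
      PiLp.add_apply, Int.cast_sub]
    have f1 := Int.floor_le ((n : ℝ) * y l)
    have f2 := Int.lt_floor_add_one ((n : ℝ) * y l)
    have f3 := Int.floor_le ((n : ℝ) * (y l + u l))
    have f4 := Int.lt_floor_add_one ((n : ℝ) * (y l + u l))
    rw [abs_le]
    constructor <;> linarith
  refine (Finset.sum_le_sum this).trans ?_
  simp

lemma hk_le {d : ℕ} (β : ℝ) (hβ0 : 0 < β) (c : Fin d → ℝ) (hc : ∀ l, 0 < c l) (n : ℕ) (hn : 0 < n)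
    (y u : EuclideanSpace ℝ (Fin d)) :
    hk β c n y u ≤ (1 + (d : ℝ)) ^ β * Dk β (Rad c) y u := by
  have hn' : (0 : ℝ) < n := by exact_mod_cast hn
  have hD := Dk_nonneg β (Rad c) y u
  have hrhs : 0 ≤ (1 + (d : ℝ)) ^ β * Dk β (Rad c) y u := by positivity
  unfold hk Fj
  split_ifs with h
  swap
  · exact hrhs
  by_cases h0 : flo n (y + u) - flo n y = 0
  · rw [h0]
    have : evec (0 : Fin d → ℤ) = 0 := by ext l; simp [evec_apply]
    rw [this, norm_zero, Real.zero_rpow (by linarith), mul_zero]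
    exact hrhs
  have h1 := one_le_norm_evec _ h0
  have h2 := flo_sub_norm n y u
  have h3 := flo_mem_ball c hc n hn _ h
  have h4 : Dk β (Rad c) y u = ‖u‖ ^ (-β) := by
    unfold Dk; rw [Set.indicator_of_mem (by simpa using h3)]
  rw [h4]
  set k := evec (flo n (y + u) - flo n y)
  have h5 : n * ‖u‖ ≤ (1 + d) * ‖k‖ := by
    have : ‖(n : ℝ) • u‖ ≤ ‖(n : ℝ) • u - k‖ + ‖k‖ := by
      have := norm_add_le ((n : ℝ) • u - k) k
      simpa using this
    rw [norm_smul, Real.norm_of_nonneg hn'.le] at this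
    nlinarith [(Nat.cast_nonneg d : (0:ℝ) ≤ d)]
  have hu : 0 < ‖u‖ := by
    rw [norm_pos_iff]
    rintro rfl
    simp at h0
  have hk0 : 0 < ‖k‖ := by linarith
  rw [Real.rpow_neg hk0.le, Real.rpow_neg hu.le, ← div_eq_mul_inv, ← div_eq_mul_inv,
    div_le_div_iff₀ (by positivity) (by positivity), ← Real.mul_rpow hn'.le hu.le,
    ← Real.mul_rpow (by positivity) hk0.le]
  exact Real.rpow_le_rpow (by positivity) h5 hβ0.le

lemma hk_int {d : ℕ} (hd : 0 < d) (β : ℝ) (hβ : β < d) (hβ0 : 0 < β) (c : Fin d → ℝ)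
    (hc : ∀ l, 0 < c l) (n : ℕ) (hn : 0 < n) (y : EuclideanSpace ℝ (Fin d)) :
    Integrable (hk β c n y) := by
  refine ((Dk_int hd β (Rad c) hβ hβ0 y).const_mul ((1 + (d : ℝ)) ^ β)).mono'
    (hk_meas β c n y).aestronglyMeasurable ?_
  filter_upwards with u
  rw [Real.norm_of_nonneg (hk_nonneg _ _ _ _ _)]
  exact hk_le β hβ0 c hc n hn y u

lemma hk_integral {d : ℕ} (hd : 0 < d) (β : ℝ) (hβ : β < d) (hβ0 : 0 < β) (c : Fin d → ℝ)
    (hc : ∀ l, 0 < c l) (n : ℕ) (hn : 0 < n) (y : EuclideanSpace ℝ (Fin d)) :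
    ∫ u, hk β c n y u = (n : ℝ) ^ (β - d) * ∑ j ∈ Gam c n, ‖evec (j - flo n y)‖ ^ (-β) := by
  have hn' : (0 : ℝ) < n := by exact_mod_cast hn
  have e1 : ∫ u, hk β c n y u = ∫ x, Fj β c n (flo n y) (flo n x) :=
    integral_add_left_eq_self (μ := volume) (fun x => Fj β c n (flo n y) (flo n x)) y
  have hi : Integrable (fun x : EuclideanSpace ℝ (Fin d) => Fj β c n (flo n y) (flo n x)) := by
    have := (hk_int hd β hβ hβ0 c hc n hn y).comp_add_left (-y)
    simpa [hk] using this
  rw [e1, integral_flo n hn _ hi, tsum_eq_sum (s := Gam c n)]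
  · rw [sub_eq_neg_add, Real.rpow_add hn', mul_assoc, Finset.mul_sum _ _ ((n:ℝ)^β)]
    congr 1
    refine Finset.sum_congr rfl fun j hj => ?_
    simp [Fj, hj]
  · intro j hj
    simp [Fj, hj]

/-- limiting kernel -/
def hlim {d : ℕ} (β : ℝ) (c : Fin d → ℝ) (y u : EuclideanSpace ℝ (Fin d)) : ℝ :=
  {x : EuclideanSpace ℝ (Fin d) | ∀ l, x l ∈ Set.Icc (-(c l)) (c l)}.indicator
    (fun _ => ‖u‖ ^ (-β)) (y + u)

lemma tendsto_floor_div {d : ℕ} {ι : Type*} {L : Filter ι} {N : ι → ℕ} (hN : Tendsto N L atTop)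
    {z : ι → ℝ} {w : ℝ} (hz : Tendsto z L (𝓝 w)) :
    Tendsto (fun p => ((⌊(N p : ℝ) * z p⌋ : ℤ) : ℝ) / N p) L (𝓝 w) := by
  have hN' : Tendsto (fun p => ((N p : ℝ))⁻¹) L (𝓝 0) :=
    tendsto_inv_atTop_zero.comp (tendsto_natCast_atTop_atTop.comp hN)
  have hlo : Tendsto (fun p => z p - ((N p : ℝ))⁻¹) L (𝓝 w) := by simpa using hz.sub hN'
  refine tendsto_of_tendsto_of_tendsto_of_le_of_le' hlo hz ?_ ?_
  · filter_upwards [hN.eventually_gt_atTop 0] with p hp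
    have hp' : (0 : ℝ) < N p := by exact_mod_cast hp
    rw [le_div_iff₀ hp', sub_mul, inv_mul_cancel₀ hp'.ne']
    linarith [Int.lt_floor_add_one ((N p : ℝ) * z p)]
  · filter_upwards [hN.eventually_gt_atTop 0] with p hp
    have hp' : (0 : ℝ) < N p := by exact_mod_cast hp
    rw [div_le_iff₀ hp']
    linarith [Int.floor_le ((N p : ℝ) * z p)]

lemma hk_tendsto {d : ℕ} (β : ℝ) (c : Fin d → ℝ)
    (y u : EuclideanSpace ℝ (Fin d)) (hu : u ≠ 0) (hb : ∀ l, |y l + u l| ≠ c l) :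
    Tendsto (fun p : ℕ × EuclideanSpace ℝ (Fin d) => hk β c p.1 p.2 u) (atTop ×ˢ 𝓝 y)
      (𝓝 (hlim β c y u)) := by
  have hN : Tendsto (fun p : ℕ × EuclideanSpace ℝ (Fin d) => p.1) (atTop ×ˢ 𝓝 y) atTop :=
    tendsto_fst
  have hy : Tendsto (fun p : ℕ × EuclideanSpace ℝ (Fin d) => p.2) (atTop ×ˢ 𝓝 y) (𝓝 y) :=
    tendsto_snd
  have hyl : ∀ l, Tendsto (fun p : ℕ × EuclideanSpace ℝ (Fin d) => p.2 l) (atTop ×ˢ 𝓝 y)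
      (𝓝 (y l)) := fun l =>
    ((by fun_prop : Continuous fun z : EuclideanSpace ℝ (Fin d) => z l).tendsto y).comp hy
  have t1 : ∀ l, Tendsto (fun p : ℕ × EuclideanSpace ℝ (Fin d) =>
      ((flo p.1 p.2 l : ℤ) : ℝ) / p.1) (atTop ×ˢ 𝓝 y) (𝓝 (y l)) := fun l =>
    tendsto_floor_div (d := d) hN (hyl l)
  have t2 : ∀ l, Tendsto (fun p : ℕ × EuclideanSpace ℝ (Fin d) =>
      ((flo p.1 (p.2 + u) l : ℤ) : ℝ) / p.1) (atTop ×ˢ 𝓝 y) (𝓝 (y l + u l)) := fun l =>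
    tendsto_floor_div (d := d) hN ((hyl l).add_const (u l))
  have t3 : ∀ l, Tendsto (fun p : ℕ × EuclideanSpace ℝ (Fin d) =>
      ((⌊c l * p.1⌋ : ℤ) : ℝ) / p.1) (atTop ×ˢ 𝓝 y) (𝓝 (c l)) := fun l => by
    have := tendsto_floor_div (d := d) hN (tendsto_const_nhds (x := c l))
    simpa only [mul_comm] using this
  by_cases hin : ∀ l, |y l + u l| < c l
  · have hmem : ∀ᶠ p : ℕ × EuclideanSpace ℝ (Fin d) in atTop ×ˢ 𝓝 y,
        flo p.1 (p.2 + u) ∈ Gam c p.1 := by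
      have h1 := fun l => (t2 l).eventually_lt (t3 l) (abs_lt.1 (hin l)).2
      have h2 := fun l => (t3 l).neg.eventually_lt (t2 l) (abs_lt.1 (hin l)).1
      filter_upwards [eventually_all.2 h1, eventually_all.2 h2, hN.eventually_gt_atTop 0]
        with p h1 h2 hp
      have hp' : (0 : ℝ) < p.1 := by exact_mod_cast hp
      rw [mem_Gam]
      intro l
      have a1 := h1 l
      have a2 := h2 l
      rw [div_lt_div_iff_of_pos_right hp'] at a1
      rw [← neg_div, div_lt_div_iff_of_pos_right hp'] at a2
      exact ⟨by exact_mod_cast a2.le, by exact_mod_cast a1.le⟩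
    have hl : hlim β c y u = ‖u‖ ^ (-β) := by
      unfold hlim
      rw [Set.indicator_of_mem]
      intro l
      have := abs_le.1 (hin l).le
      exact ⟨this.1, this.2⟩
    rw [hl]
    have tn : Tendsto (fun p : ℕ × EuclideanSpace ℝ (Fin d) =>
        ((p.1 : ℝ))⁻¹ • evec (flo p.1 (p.2 + u) - flo p.1 p.2)) (atTop ×ˢ 𝓝 y) (𝓝 u) := by
      have hpi : Tendsto (fun p : ℕ × EuclideanSpace ℝ (Fin d) => WithLp.toLp 2 (fun l : Fin d =>
          ((flo p.1 (p.2 + u) l : ℤ) : ℝ) / p.1 - ((flo p.1 p.2 l : ℤ) : ℝ) / p.1))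
          (atTop ×ˢ 𝓝 y) (𝓝 (WithLp.toLp 2 (fun l : Fin d => y l + u l - y l))) :=
        ((PiLp.continuous_toLp 2 (fun _ : Fin d => ℝ)).tendsto _).comp
          (tendsto_pi_nhds.2 fun l => (t2 l).sub (t1 l))
      have e : WithLp.toLp 2 (fun l : Fin d => y l + u l - y l) = u := by
        ext l; simp
      rw [e] at hpi
      refine hpi.congr fun p => ?_
      ext l
      simp only [PiLp.smul_apply, evec_apply, Pi.sub_apply, smul_eq_mul, Int.cast_sub]
      ring
    have tn2 := (tn.norm).rpow_const (p := -β) (Or.inl (norm_ne_zero_iff.2 hu))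
    refine tn2.congr' ?_
    filter_upwards [hmem, hN.eventually_gt_atTop 0] with p hp hp0
    have hp' : (0 : ℝ) < p.1 := by exact_mod_cast hp0
    simp only [hk, Fj, hp, if_true]
    rw [norm_smul, Real.mul_rpow (norm_nonneg _) (norm_nonneg _), Real.norm_of_nonneg (by positivity),
      Real.inv_rpow hp'.le, Real.rpow_neg hp'.le, inv_inv]
  · push Not at hin
    obtain ⟨l, hl⟩ := hin
    have hl' : c l < |y l + u l| := lt_of_le_of_ne hl (hb l).symm
    have hz : hlim β c y u = 0 := by
      unfold hlim
      rw [Set.indicator_of_notMem]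
      intro hm
      have := hm l
      exact absurd (abs_le.2 ⟨this.1, this.2⟩) (not_le.2 hl')
    rw [hz]
    refine tendsto_const_nhds.congr' ?_
    filter_upwards [(t3 l).eventually_lt (t2 l).abs hl', hN.eventually_gt_atTop 0] with p hp hp0
    have hp' : (0 : ℝ) < p.1 := by exact_mod_cast hp0
    have hnm : flo p.1 (p.2 + u) ∉ Gam c p.1 := by
      rw [mem_Gam]
      intro hm
      obtain ⟨m1, m2⟩ := hm l
      rw [abs_div, Nat.abs_cast, div_lt_div_iff_of_pos_right hp'] at hp
      have : |flo p.1 (p.2 + u) l| ≤ ⌊c l * p.1⌋ := abs_le.2 ⟨m1, m2⟩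
      have : ((|flo p.1 (p.2 + u) l| : ℤ) : ℝ) ≤ ((⌊c l * p.1⌋ : ℤ) : ℝ) := by exact_mod_cast this
      rw [Int.cast_abs] at this
      linarith
    simp [hk, Fj, hnm]

lemma Dk_mono {d : ℕ} (β R : ℝ) (y y' u : EuclideanSpace ℝ (Fin d)) (h : ‖y' - y‖ ≤ 1) :
    Dk β R y' u ≤ Dk β (R + 1) y u := by
  by_cases hm : y' + u ∈ Metric.closedBall (0 : EuclideanSpace ℝ (Fin d)) R
  · have h1 : ‖y' + u‖ ≤ R := by simpa using hm
    have h2 : y + u ∈ Metric.closedBall (0 : EuclideanSpace ℝ (Fin d)) (R + 1) := by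
      have e : y + u = (y' + u) - (y' - y) := by abel
      have := norm_sub_le (y' + u) (y' - y)
      rw [mem_closedBall_zero_iff, e]
      linarith
    unfold Dk
    rw [Set.indicator_of_mem hm, Set.indicator_of_mem h2]
  · have : Dk β R y' u = 0 := by unfold Dk; rw [Set.indicator_of_notMem hm]
    rw [this]
    exact Dk_nonneg _ _ _ _

/-- discretised potential -/
def gn {d : ℕ} (β : ℝ) (c : Fin d → ℝ) (n : ℕ) (y : EuclideanSpace ℝ (Fin d)) : ℝ :=
  ∫ u, hk β c n y u

/-- limiting potential -/
def gl {d : ℕ} (β : ℝ) (c : Fin d → ℝ) (y : EuclideanSpace ℝ (Fin d)) : ℝ :=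
  ∫ u, hlim β c y u

lemma gn_nonneg {d : ℕ} (β : ℝ) (c : Fin d → ℝ) (n : ℕ) (y : EuclideanSpace ℝ (Fin d)) :
    0 ≤ gn β c n y := integral_nonneg fun u => hk_nonneg β c n y u

lemma gn_tendsto {d : ℕ} (hd : 0 < d) (β : ℝ) (hβ : β < d) (hβ0 : 0 < β) (c : Fin d → ℝ)
    (hc : ∀ l, 0 < c l) (y : EuclideanSpace ℝ (Fin d)) :
    Tendsto (fun p : ℕ × EuclideanSpace ℝ (Fin d) => gn β c p.1 p.2) (atTop ×ˢ 𝓝 y)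
      (𝓝 (gl β c y)) := by
  have hN : Tendsto (fun p : ℕ × EuclideanSpace ℝ (Fin d) => p.1) (atTop ×ˢ 𝓝 y) atTop :=
    tendsto_fst
  have hy : Tendsto (fun p : ℕ × EuclideanSpace ℝ (Fin d) => p.2) (atTop ×ˢ 𝓝 y) (𝓝 y) :=
    tendsto_snd
  refine tendsto_integral_filter_of_dominated_convergence
    (fun u => (1 + (d : ℝ)) ^ β * Dk β (Rad c + 1) y u) ?_ ?_ ?_ ?_
  · exact Eventually.of_forall fun p => (hk_meas β c p.1 p.2).aestronglyMeasurable
  · filter_upwards [hN.eventually_gt_atTop 0, hy.eventually (Metric.closedBall_mem_nhds y one_pos)]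
      with p hp hp2
    have hp2' : ‖p.2 - y‖ ≤ 1 := by
      have : dist p.2 y ≤ 1 := hp2
      rwa [dist_eq_norm] at this
    filter_upwards with u
    rw [Real.norm_of_nonneg (hk_nonneg _ _ _ _ _)]
    refine (hk_le β hβ0 c hc p.1 hp p.2 u).trans ?_
    exact mul_le_mul_of_nonneg_left (Dk_mono β _ y p.2 u hp2') (by positivity)
  · exact (Dk_int hd β _ hβ hβ0 y).const_mul _
  · have h1 : ∀ᵐ u : EuclideanSpace ℝ (Fin d), ∀ l, u l ≠ c l - y l :=
      ae_all_iff.2 fun l => ae_coord_ne l _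
    have h2 : ∀ᵐ u : EuclideanSpace ℝ (Fin d), ∀ l, u l ≠ -c l - y l :=
      ae_all_iff.2 fun l => ae_coord_ne l _
    filter_upwards [h1, h2, ae_coord_ne (⟨0, hd⟩ : Fin d) 0] with u h1 h2 h3
    refine hk_tendsto β c y u ?_ ?_
    · rintro rfl
      exact h3 rfl
    · intro l hl
      rcases eq_or_eq_neg_of_abs_eq hl with h | h
      · exact h1 l (by linarith)
      · exact h2 l (by linarith)

lemma gn_tendsto' {d : ℕ} (hd : 0 < d) (β : ℝ) (hβ : β < d) (hβ0 : 0 < β) (c : Fin d → ℝ)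
    (hc : ∀ l, 0 < c l) (y : EuclideanSpace ℝ (Fin d)) :
    Tendsto (fun n : ℕ => gn β c n y) atTop (𝓝 (gl β c y)) := by
  have h : Tendsto (fun n : ℕ => (n, y)) atTop (atTop ×ˢ 𝓝 y) :=
    Tendsto.prodMk (f := atTop) (m₁ := fun n : ℕ => n) (m₂ := fun _ => y)
      tendsto_id tendsto_const_nhds
  have h2 := gn_tendsto hd β hβ hβ0 c hc y
  have h3 := h2.comp h
  simpa only [Function.comp_def] using h3

lemma gn_bound {d : ℕ} (hd : 0 < d) (β : ℝ) (hβ : β < d) (hβ0 : 0 < β) (c : Fin d → ℝ)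
    (hc : ∀ l, 0 < c l) : ∃ C : ℝ, 0 < C ∧ ∀ (n : ℕ), 0 < n → ∀ y : EuclideanSpace ℝ (Fin d),
      gn β c n y ≤ C * (1 + ‖y‖) ^ (-β) := by
  obtain ⟨C, hC, h⟩ := Dk_integral_le hd β (Rad c) hβ hβ0 (one_le_Rad c hc)
  refine ⟨(1 + (d : ℝ)) ^ β * C, by positivity, fun n hn y => ?_⟩
  refine (integral_mono (hk_int hd β hβ hβ0 c hc n hn y)
    ((Dk_int hd β (Rad c) hβ hβ0 y).const_mul ((1 + (d : ℝ)) ^ β))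
    (hk_le β hβ0 c hc n hn y)).trans ?_
  rw [integral_const_mul, mul_assoc]
  exact mul_le_mul_of_nonneg_left (h y) (by positivity)

lemma measurableSet_box {d : ℕ} (c : Fin d → ℝ) :
    MeasurableSet {x : EuclideanSpace ℝ (Fin d) | ∀ l, x l ∈ Set.Icc (-(c l)) (c l)} := by
  have : {x : EuclideanSpace ℝ (Fin d) | ∀ l, x l ∈ Set.Icc (-(c l)) (c l)} =
      ⋂ l, (fun x : EuclideanSpace ℝ (Fin d) => x l) ⁻¹' Set.Icc (-(c l)) (c l) := by
    ext x; simp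
  rw [this]
  exact MeasurableSet.iInter fun l => measurableSet_Icc.preimage (by fun_prop)

lemma gl_eq {d : ℕ} (β : ℝ) (c : Fin d → ℝ) (y : EuclideanSpace ℝ (Fin d)) :
    ∫ x in {x : EuclideanSpace ℝ (Fin d) | ∀ l, x l ∈ Set.Icc (-(c l)) (c l)}, ‖x - y‖ ^ (-β)
      = gl β c y := by
  rw [← integral_indicator (measurableSet_box c), ← integral_add_left_eq_self _ y]
  unfold gl hlim
  refine integral_congr_ae (Eventually.of_forall fun u => ?_)
  simp [Set.indicator]

lemma hlim_nonneg {d : ℕ} (β : ℝ) (c : Fin d → ℝ) (y u : EuclideanSpace ℝ (Fin d)) :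
    0 ≤ hlim β c y u := Set.indicator_nonneg (fun _ _ => by positivity) _

lemma gl_pos {d : ℕ} (hd : 0 < d) (β : ℝ) (hβ : β < d) (hβ0 : 0 < β) (c : Fin d → ℝ)
    (hc : ∀ l, 0 < c l) (y : EuclideanSpace ℝ (Fin d)) : 0 < gl β c y := by
  have hle : ∀ u, hlim β c y u ≤ Dk β (Rad c) y u := by
    intro u
    by_cases hm : y + u ∈ {x : EuclideanSpace ℝ (Fin d) | ∀ l, x l ∈ Set.Icc (-(c l)) (c l)}
    · have h2 : y + u ∈ Metric.closedBall (0 : EuclideanSpace ℝ (Fin d)) (Rad c) := by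
        rw [mem_closedBall_zero_iff]
        refine (norm_le_sum_abs _).trans ?_
        have : ∑ l, |(y + u) l| ≤ ∑ l, (c l + 1) := by
          refine Finset.sum_le_sum fun l _ => ?_
          have := abs_le.2 (hm l)
          linarith
        unfold Rad
        linarith
      unfold hlim Dk
      rw [Set.indicator_of_mem hm, Set.indicator_of_mem h2]
    · have : hlim β c y u = 0 := by unfold hlim; rw [Set.indicator_of_notMem hm]
      rw [this]
      exact Dk_nonneg _ _ _ _
  have hmeas : Measurable (hlim β c y) := by
    have : hlim β c y = fun u => ((fun u => y + u) ⁻¹'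
        {x : EuclideanSpace ℝ (Fin d) | ∀ l, x l ∈ Set.Icc (-(c l)) (c l)}).indicator
          (fun u => ‖u‖ ^ (-β)) u := rfl
    rw [this]
    refine Measurable.indicator (by fun_prop) ?_
    exact (measurableSet_box c).preimage (by fun_prop)
  have hint : Integrable (hlim β c y) := by
    refine (Dk_int hd β (Rad c) hβ hβ0 y).mono' hmeas.aestronglyMeasurable ?_
    filter_upwards with u
    rw [Real.norm_of_nonneg (hlim_nonneg _ _ _ _)]
    exact hle u
  unfold gl
  rw [integral_pos_iff_support_of_nonneg (hlim_nonneg β c y) hint]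
  -- an open set inside the support, up to the origin
  set U : Set (EuclideanSpace ℝ (Fin d)) := {u | ∀ l, |y l + u l| < c l} with hU
  have hUo : IsOpen U := by
    have : U = ⋂ l, {u : EuclideanSpace ℝ (Fin d) | |y l + u l| < c l} := by
      ext u; simp [hU]
    rw [this]
    exact isOpen_iInter_of_finite fun l => isOpen_lt (by fun_prop) (by fun_prop)
  have hUn : U.Nonempty := ⟨-y, fun l => by simpa using hc l⟩
  have hUpos : 0 < volume U := hUo.measure_pos volume hUn
  refine hUpos.trans_le (measure_mono_ae ?_)
  filter_upwards [ae_coord_ne (⟨0, hd⟩ : Fin d) 0] with u h3 hu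
  have hu' : ∀ l, |y l + u l| < c l := hu
  have hu0 : 0 < ‖u‖ := by
    rw [norm_pos_iff]
    rintro rfl
    exact h3 rfl
  have : hlim β c y u = ‖u‖ ^ (-β) := by
    unfold hlim
    rw [Set.indicator_of_mem]
    intro l
    exact abs_le.1 (hu' l).le
  change hlim β c y u ≠ 0
  rw [this]
  positivity

lemma int_pow_facts {d : ℕ} (hd : 0 < d) (α β : ℝ) (hα : 0 < α) (hβ : β < d)
    (hαβ : (d : ℝ) < α * β) (hβ0 : 0 < β) (c : Fin d → ℝ) (hc : ∀ l, 0 < c l) :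
    (∀ n, 0 < n → Integrable (fun y : EuclideanSpace ℝ (Fin d) => gn β c n y ^ α)) ∧
    Tendsto (fun n : ℕ => ∫ y : EuclideanSpace ℝ (Fin d), gn β c n y ^ α) atTop
      (𝓝 (∫ y, gl β c y ^ α)) ∧ 0 < ∫ y : EuclideanSpace ℝ (Fin d), gl β c y ^ α := by
  obtain ⟨C, hC, hb⟩ := gn_bound hd β hβ hβ0 c hc
  have hbi : Integrable (fun y : EuclideanSpace ℝ (Fin d) => C ^ α * (1 + ‖y‖) ^ (-(α * β))) :=
    (integrable_one_add_norm (by simpa using hαβ)).const_mul _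
  have hrw : ∀ y : EuclideanSpace ℝ (Fin d),
      (C * (1 + ‖y‖) ^ (-β)) ^ α = C ^ α * (1 + ‖y‖) ^ (-(α * β)) := by
    intro y
    rw [Real.mul_rpow hC.le (by positivity), ← Real.rpow_mul (by positivity)]
    congr 2; ring
  have hbp : ∀ n, 0 < n → ∀ y : EuclideanSpace ℝ (Fin d),
      gn β c n y ^ α ≤ C ^ α * (1 + ‖y‖) ^ (-(α * β)) := by
    intro n hn y
    rw [← hrw y]
    exact Real.rpow_le_rpow (gn_nonneg _ _ _ _) (hb n hn y) hα.le
  have hm : ∀ n, 0 < n → AEStronglyMeasurable (fun y : EuclideanSpace ℝ (Fin d) =>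
      gn β c n y ^ α) volume := by
    intro n hn
    have e : (fun y : EuclideanSpace ℝ (Fin d) => gn β c n y ^ α) = (fun i : Fin d → ℤ =>
        ((n : ℝ) ^ (β - d) * ∑ j ∈ Gam c n, ‖evec (j - i)‖ ^ (-β)) ^ α) ∘ flo n := by
      ext y
      simp only [gn, hk_integral hd β hβ hβ0 c hc n hn y, Function.comp]
    rw [e]
    exact ((measurable_of_countable _).comp (measurable_flo n)).aestronglyMeasurable
  have hpt : ∀ y : EuclideanSpace ℝ (Fin d), Tendsto (fun n : ℕ => gn β c n y ^ α) atTop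
      (𝓝 (gl β c y ^ α)) := fun y =>
    (gn_tendsto' hd β hβ hβ0 c hc y).rpow_const (Or.inr hα.le)
  refine ⟨fun n hn => ?_, ?_, ?_⟩
  · refine hbi.mono' (hm n hn) ?_
    filter_upwards with y
    rw [Real.norm_of_nonneg (Real.rpow_nonneg (gn_nonneg _ _ _ _) _)]
    exact hbp n hn y
  · refine tendsto_integral_filter_of_dominated_convergence _ ?_ ?_ hbi ?_
    · filter_upwards [eventually_gt_atTop 0] with n hn using hm n hn
    · filter_upwards [eventually_gt_atTop 0] with n hn
      filter_upwards with y
      rw [Real.norm_of_nonneg (Real.rpow_nonneg (gn_nonneg _ _ _ _) _)]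
      exact hbp n hn y
    · exact Eventually.of_forall hpt
  · have hpos : ∀ y : EuclideanSpace ℝ (Fin d), 0 < gl β c y ^ α := fun y =>
      Real.rpow_pos_of_pos (gl_pos hd β hβ hβ0 c hc y) α
    have hgi : Integrable (fun y : EuclideanSpace ℝ (Fin d) => gl β c y ^ α) := by
      refine hbi.mono' ?_ ?_
      · refine aestronglyMeasurable_of_tendsto_ae atTop
          (f := fun (n : ℕ) y => gn β c (n + 1) y ^ α) (fun n => hm (n + 1) n.succ_pos) ?_
        exact Eventually.of_forall fun y => (hpt y).comp (tendsto_add_atTop_nat 1)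
      · filter_upwards with y
        rw [Real.norm_of_nonneg (hpos y).le]
        refine le_of_tendsto (hpt y) ?_
        filter_upwards [eventually_gt_atTop 0] with n hn using hbp n hn y
    rw [integral_pos_iff_support_of_nonneg (fun y => (hpos y).le) hgi]
    have : Function.support (fun y : EuclideanSpace ℝ (Fin d) => gl β c y ^ α) = Set.univ := by
      ext y; simpa using (hpos y).ne'
    rw [this]
    exact isOpen_univ.measure_pos volume Set.univ_nonempty

lemma flo_evec {d : ℕ} (n : ℕ) (hn : 0 < n) (i : Fin d → ℤ) :
    flo n ((n : ℝ)⁻¹ • evec i) = i := by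
  have hn' : (n : ℝ) ≠ 0 := by exact_mod_cast hn.ne'
  ext l
  simp [flo, evec_apply, hn']

lemma sup_facts {d : ℕ} (hd : 0 < d) (β : ℝ) (hβ : β < d) (hβ0 : 0 < β) (c : Fin d → ℝ)
    (hc : ∀ l, 0 < c l) : ∃ S : ℝ, 0 < S ∧ ∀ ε > 0, ∀ᶠ n : ℕ in atTop,
      (∀ y : EuclideanSpace ℝ (Fin d), gn β c n y ≤ S + ε) ∧
      ∃ y : EuclideanSpace ℝ (Fin d), S - ε < gn β c n y := by
  obtain ⟨C, hC, hb⟩ := gn_bound hd β hβ hβ0 c hc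
  have hgb : ∀ y : EuclideanSpace ℝ (Fin d), gl β c y ≤ C := by
    intro y
    refine le_of_tendsto (gn_tendsto' hd β hβ hβ0 c hc y) ?_
    filter_upwards [eventually_gt_atTop 0] with n hn
    refine (hb n hn y).trans ?_
    have := Real.rpow_le_one_of_one_le_of_nonpos (x := 1 + ‖y‖) (z := -β)
      (by linarith [norm_nonneg y]) (by linarith)
    nlinarith
  have hbdd : BddAbove (Set.range (gl β c : EuclideanSpace ℝ (Fin d) → ℝ)) :=
    ⟨C, by rintro _ ⟨y, rfl⟩; exact hgb y⟩
  refine ⟨⨆ y, gl β c y, ?_, ?_⟩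
  · exact (gl_pos hd β hβ hβ0 c hc 0).trans_le (le_ciSup hbdd 0)
  intro ε hε
  set S := ⨆ y : EuclideanSpace ℝ (Fin d), gl β c y with hS
  have hSpos : 0 < S := (gl_pos hd β hβ hβ0 c hc 0).trans_le (le_ciSup hbdd 0)
  -- far part
  obtain ⟨R, hR⟩ : ∃ R : ℝ, ∀ y : EuclideanSpace ℝ (Fin d), R < ‖y‖ →
      C * (1 + ‖y‖) ^ (-β) < S := by
    have t : Tendsto (fun r : ℝ => C * (1 + r) ^ (-β)) atTop (𝓝 (C * 0)) :=
      ((tendsto_rpow_neg_atTop hβ0).comp (tendsto_atTop_add_const_left _ 1 tendsto_id)).const_mul C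
    rw [mul_zero] at t
    obtain ⟨R, hR⟩ := eventually_atTop.1 (t.eventually_lt_const hSpos)
    exact ⟨R, fun y hy => hR _ hy.le⟩
  have hK : IsCompact (Metric.closedBall (0 : EuclideanSpace ℝ (Fin d)) R) :=
    isCompact_closedBall 0 R
  have hnear : ∀ᶠ n : ℕ in atTop, ∀ y ∈ Metric.closedBall (0 : EuclideanSpace ℝ (Fin d)) R,
      gn β c n y < S + ε := by
    have h1 : ∀ y ∈ Metric.closedBall (0 : EuclideanSpace ℝ (Fin d)) R,
        ∃ t ∈ 𝓝[Metric.closedBall (0 : EuclideanSpace ℝ (Fin d)) R] y,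
          ∀ᶠ n : ℕ in atTop, ∀ z ∈ t, gn β c n z < S + ε := by
      intro y _
      have hlt : gl β c y < S + ε := by
        have := le_ciSup hbdd y
        linarith
      have := (gn_tendsto hd β hβ hβ0 c hc y).eventually_lt_const hlt
      obtain ⟨pa, ha, pb, hb', hab⟩ := eventually_prod_iff.1 this
      exact ⟨{z | pb z}, mem_nhdsWithin_of_mem_nhds hb', ha.mono fun n hn z hz => hab hn hz⟩
    refine hK.induction_on (p := fun s => ∀ᶠ n : ℕ in atTop, ∀ y ∈ s, gn β c n y < S + ε)
      ?_ ?_ ?_ h1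
    · simp
    · intro s t hst ht
      exact ht.mono fun n hn y hy => hn y (hst hy)
    · intro s t hs ht
      filter_upwards [hs, ht] with n h1 h2 y hy
      exact hy.elim (h1 y) (h2 y)
  obtain ⟨y0, hy0⟩ := exists_lt_of_lt_ciSup (show S - ε < S by linarith)
  filter_upwards [hnear, eventually_gt_atTop 0,
    (gn_tendsto' hd β hβ hβ0 c hc y0).eventually_const_lt hy0] with n h1 hn h3
  refine ⟨fun y => ?_, y0, h3⟩
  by_cases hy : y ∈ Metric.closedBall (0 : EuclideanSpace ℝ (Fin d)) R
  · exact (h1 y hy).le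
  · have : R < ‖y‖ := by simpa using hy
    linarith [hR y this, hb n hn y]

/-- asymptotics of the normalizer for the linear random field with
isotropic coefficients `a_i = ‖i‖^{-β}` over the regions `Γ_n = {k : |k_l| ≤ c_l n}`
(case `L ≡ 1`): `B_n ~ n^{d-β+d/α} (∫_{ℝ^d}|∫_I ‖x-y‖^{-β}dx|^α dy)^{1/α}`,
`B_n ~ C₁ n^{(1+1/α)d-β}` and `sup_i |b_{ni}| ~ C₂ n^{d-β}`. -/
theorem stmt18
    (d : ℕ) (hd : 0 < d) (α β : ℝ) (hα : 0 < α) (hα2 : α ≤ 2)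
    (hβ : β < d) (hαβ : (d : ℝ) < α * β) (hβ0 : 0 < β)
    (c : Fin d → ℝ) (hc : ∀ l, 0 < c l)
    (I : Set (EuclideanSpace ℝ (Fin d)))
    (hI : I = {x | ∀ l, x l ∈ Set.Icc (-(c l)) (c l)})
    -- `Γ_n = {k ∈ ℤ^d : |k_l| ≤ c_l n}`
    (Γ : ℕ → Finset (Fin d → ℤ))
    (hΓ : ∀ n, Γ n = Fintype.piFinset fun l => Finset.Icc (-(⌊c l * n⌋)) ⌊c l * n⌋)
    -- `b_{ni} = Σ_{j ∈ Γ_n} ‖j - i‖^{-β}`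
    (b : ℕ → (Fin d → ℤ) → ℝ)
    (hb : ∀ n i, b n i = ∑ j ∈ Γ n, ‖evec (j - i)‖ ^ (-β))
    (B : ℕ → ℝ) (hB : ∀ n, B n = (∑' i, |b n i| ^ α) ^ (1/α)) :
    Tendsto (fun n : ℕ => B n /
        ((n : ℝ) ^ ((d : ℝ) - β + (d : ℝ)/α) *
          (∫ y : EuclideanSpace ℝ (Fin d), |∫ x in I, ‖x - y‖ ^ (-β)| ^ α) ^ (1/α)))
      atTop (nhds 1) ∧
    (∃ C₁ : ℝ, 0 < C₁ ∧
      Tendsto (fun n : ℕ => B n / (C₁ * (n : ℝ) ^ ((1 + 1/α) * d - β))) atTop (nhds 1)) ∧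
    (∃ C₂ : ℝ, 0 < C₂ ∧
      Tendsto (fun n : ℕ => (⨆ i : Fin d → ℤ, |b n i|) / (C₂ * (n : ℝ) ^ ((d : ℝ) - β)))
        atTop (nhds 1)) := by
  have hΓ' : ∀ n, Γ n = Gam c n := hΓ
  obtain ⟨hint, hlimI, hIpos⟩ := int_pow_facts hd α β hα hβ hαβ hβ0 c hc
  have hJ : (∫ y : EuclideanSpace ℝ (Fin d), |∫ x in I, ‖x - y‖ ^ (-β)| ^ α)
      = ∫ y : EuclideanSpace ℝ (Fin d), gl β c y ^ α := by
    refine integral_congr_ae (Eventually.of_forall fun y => ?_)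
    simp only [hI]
    rw [gl_eq, abs_of_pos (gl_pos hd β hβ hβ0 c hc y)]
  have hbg : ∀ n, 0 < n → ∀ y, gn β c n y = (n : ℝ) ^ (β - d) * b n (flo n y) := by
    intro n hn y
    rw [gn, hk_integral hd β hβ hβ0 c hc n hn y, hb, hΓ']
  have hb0 : ∀ n i, 0 ≤ b n i := by
    intro n i
    rw [hb]
    exact Finset.sum_nonneg fun _ _ => by positivity
  set J : ℝ := ∫ y : EuclideanSpace ℝ (Fin d), gl β c y ^ α with hJdef
  have hBn : ∀ n : ℕ, 0 < n → B n = (n : ℝ) ^ ((d : ℝ) - β + (d : ℝ)/α) *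
      (∫ y : EuclideanSpace ℝ (Fin d), gn β c n y ^ α) ^ (1/α) := by
    intro n hn
    have hn' : (0 : ℝ) < n := by exact_mod_cast hn
    have e : ∀ y : EuclideanSpace ℝ (Fin d), gn β c n y ^ α =
        (fun i => ((n : ℝ) ^ (β - d)) ^ α * |b n i| ^ α) (flo n y) := by
      intro y
      simp only
      rw [hbg n hn y, Real.mul_rpow (by positivity) (hb0 _ _), abs_of_nonneg (hb0 _ _)]
    have hi := hint n hn
    simp only [e] at hi ⊢
    have h2 := integral_flo n hn (fun i => ((n : ℝ) ^ (β - d)) ^ α * |b n i| ^ α) hi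
    rw [h2, tsum_mul_left, hB n]
    have hT : 0 ≤ ∑' i, |b n i| ^ α := tsum_nonneg fun i => by positivity
    rw [← mul_assoc, Real.mul_rpow (by positivity) hT, ← mul_assoc, ← Real.rpow_mul hn'.le,
      ← Real.rpow_add hn', ← Real.rpow_mul hn'.le, ← Real.rpow_add hn']
    have : (d : ℝ) - β + (d : ℝ)/α + (-(d : ℝ) + (β - d) * α) * (1/α) = 0 := by
      field_simp
      ring
    rw [this, Real.rpow_zero, one_mul]
  have hJp : 0 < J ^ (1/α) := Real.rpow_pos_of_pos hIpos _
  have hT1 : Tendsto (fun n : ℕ => B n / ((n : ℝ) ^ ((d : ℝ) - β + (d : ℝ)/α) * J ^ (1/α)))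
      atTop (nhds 1) := by
    have t : Tendsto (fun n : ℕ => (∫ y : EuclideanSpace ℝ (Fin d), gn β c n y ^ α) ^ (1/α)
        / J ^ (1/α)) atTop (𝓝 (J ^ (1/α) / J ^ (1/α))) :=
      (hlimI.rpow_const (Or.inl hIpos.ne')).div_const _
    rw [div_self hJp.ne'] at t
    refine t.congr' ?_
    filter_upwards [eventually_gt_atTop 0] with n hn
    have hn' : (0 : ℝ) < n := by exact_mod_cast hn
    rw [hBn n hn, mul_div_mul_left _ _ (by positivity)]
  refine ⟨by rw [hJ]; exact hT1, ⟨J ^ (1/α), hJp, ?_⟩, ?_⟩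
  · refine hT1.congr fun n => ?_
    have : (d : ℝ) - β + (d : ℝ)/α = (1 + 1/α) * d - β := by ring
    rw [this, mul_comm (J ^ (1/α))]
  · obtain ⟨S, hS, hsup⟩ := sup_facts hd β hβ hβ0 c hc
    refine ⟨S, hS, ?_⟩
    have key : Tendsto (fun n : ℕ => (⨆ i : Fin d → ℤ, |b n i|) * (n : ℝ) ^ (β - d)) atTop
        (𝓝 S) := by
      rw [Metric.tendsto_nhds]
      intro ε hε
      filter_upwards [hsup (ε / 2) (by linarith), eventually_gt_atTop 0] with n ⟨h1, y, h2⟩ hn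
      have hn' : (0 : ℝ) < n := by exact_mod_cast hn
      have hp : 0 < (n : ℝ) ^ (β - d) := by positivity
      have hbi : ∀ i, |b n i| ≤ (S + ε / 2) / (n : ℝ) ^ (β - d) := by
        intro i
        rw [abs_of_nonneg (hb0 _ _), le_div_iff₀ hp, mul_comm]
        have := h1 ((n : ℝ)⁻¹ • evec i)
        rwa [hbg n hn, flo_evec n hn] at this
      have u1 : (⨆ i : Fin d → ℤ, |b n i|) * (n : ℝ) ^ (β - d) ≤ S + ε / 2 := by
        rw [← le_div_iff₀ hp]
        exact ciSup_le hbi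
      have u2 : S - ε / 2 < (⨆ i : Fin d → ℤ, |b n i|) * (n : ℝ) ^ (β - d) := by
        rw [hbg n hn, mul_comm] at h2
        refine h2.trans_le (mul_le_mul_of_nonneg_right ?_ hp.le)
        refine (le_abs_self _).trans ?_
        exact le_ciSup (f := fun i => |b n i|) ⟨_, by rintro _ ⟨i, rfl⟩; exact hbi i⟩ (flo n y)
      rw [Real.dist_eq, abs_lt]
      constructor <;> linarith
    have t := key.div_const S
    rw [div_self hS.ne'] at t
    refine t.congr' ?_
    filter_upwards [eventually_gt_atTop 0] with n hn
    have hn' : (0 : ℝ) < n := by exact_mod_cast hn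
    have : (n : ℝ) ^ (β - d) = ((n : ℝ) ^ ((d : ℝ) - β))⁻¹ := by
      rw [← Real.rpow_neg hn'.le, neg_sub]
    rw [this]
    field_simp

end
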